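/- arXiv:1501.03070 — 2 statements merged into one kernel-verified Lean document; each statement's English description precedes it below -/
import Mathlib

section
/- Let n ∈ {2, 3} and let A, B ∈ ℝ^{n×n} be polytropes. Then A ⊙ B = B ⊙ A if and only if both A ⊙ B = A ⊕ B and B ⊙ A = A ⊕ B. -/
namespace TropComm

variable {n : ℕ}

/-- Tropical (min-plus) matrix product: `(A ⊙ B) i j = min_s (A i s + B s j)`. -/
def tropMul [NeZero n] (A B : Fin n → Fin n → ℝ) : Fin n → Fin n → ℝ :=
  fun i j => Finset.univ.inf' Finset.univ_nonempty (fun s => A i s + B s j)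

/-- Tropical matrix-vector product: `(A ⊙ x) i = min_j (A i j + x j)`. -/
def tropMulVec [NeZero n] (A : Fin n → Fin n → ℝ) (x : Fin n → ℝ) : Fin n → ℝ :=
  fun i => Finset.univ.inf' Finset.univ_nonempty (fun j => A i j + x j)

/-- Tropical sum: entrywise minimum. -/
def tropSum (A B : Fin n → Fin n → ℝ) : Fin n → Fin n → ℝ :=
  fun i j => min (A i j) (B i j)

/-- `tropPow A k` is the k-fold tropical product `A^{⊙k}` (with the junk value
`tropPow A 0 = A`; only exponents `k ≥ 1` are ever used). -/
def tropPow [NeZero n] (A : Fin n → Fin n → ℝ) : ℕ → (Fin n → Fin n → ℝ)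
  | 0 => A
  | 1 => A
  | (k + 2) => tropMul A (tropPow A (k + 1))

/-- Kleene star `A* = A ⊕ A^{⊙2} ⊕ ⋯ ⊕ A^{⊙n}`. -/
def kleene [NeZero n] (A : Fin n → Fin n → ℝ) : Fin n → Fin n → ℝ :=
  fun i j => Finset.univ.inf' Finset.univ_nonempty (fun k : Fin n => tropPow A (k.val + 1) i j)

/-- A premetric: zero diagonal, positive off-diagonal entries. -/
def IsPremetric (A : Fin n → Fin n → ℝ) : Prop :=
  (∀ i, A i i = 0) ∧ ∀ i j, i ≠ j → 0 < A i j

/-- A polytrope: a premetric satisfying the triangle inequality. -/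
def IsPolytrope (A : Fin n → Fin n → ℝ) : Prop :=
  IsPremetric A ∧ ∀ i j k, A i j ≤ A i k + A k j


lemma IsPolytrope.nonneg {A : Fin n → Fin n → ℝ} (hA : IsPolytrope A) (i j : Fin n) :
    0 ≤ A i j := by
  by_cases h : i = j
  · rw [h, hA.1.1 j]
  · exact (hA.1.2 i j h).le

lemma tropMul_le [NeZero n] (A B : Fin n → Fin n → ℝ) (i j s : Fin n) :
    tropMul A B i j ≤ A i s + B s j :=
  Finset.inf'_le _ (Finset.mem_univ s)

lemma exists_tropMul_eq [NeZero n] (A B : Fin n → Fin n → ℝ) (i j : Fin n) :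
    ∃ s, tropMul A B i j = A i s + B s j := by
  obtain ⟨s, -, hs⟩ := Finset.exists_mem_eq_inf' Finset.univ_nonempty (fun s => A i s + B s j)
  exact ⟨s, hs⟩

lemma tropMul_le_tropSum [NeZero n] {A B : Fin n → Fin n → ℝ}
    (hA : ∀ i, A i i = 0) (hB : ∀ i, B i i = 0) (i j : Fin n) :
    tropMul A B i j ≤ tropSum A B i j := by
  have h₁ := tropMul_le A B i j i
  have h₂ := tropMul_le A B i j j
  rw [hA, zero_add] at h₁
  rw [hB, add_zero] at h₂
  exact le_min h₂ h₁

/-- Commuting polytropes of size at most three multiply to their tropical sum. -/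
lemma tropMul_eq_tropSum_of_comm [NeZero n] (hn : n ≤ 3) {A B : Fin n → Fin n → ℝ}
    (hA : IsPolytrope A) (hB : IsPolytrope B) (h : tropMul A B = tropMul B A) :
    tropMul A B = tropSum A B := by
  funext i j
  refine le_antisymm (tropMul_le_tropSum hA.1.1 hB.1.1 i j) ?_
  obtain ⟨s, hs⟩ := exists_tropMul_eq A B i j
  obtain ⟨t, ht⟩ := exists_tropMul_eq B A i j
  rw [← h] at ht
  by_contra! hlt
  obtain ⟨hltA, hltB⟩ := lt_min_iff.1 hlt
  have hij : i ≠ j := by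
    rintro rfl
    linarith [hA.1.1 i, hA.nonneg i s, hB.nonneg s i]
  have hsi : s ≠ i := by
    rintro rfl
    linarith [hA.1.1 s]
  have hsj : s ≠ j := by
    rintro rfl
    linarith [hB.1.1 s]
  have hti : t ≠ i := by
    rintro rfl
    linarith [hB.1.1 t]
  have htj : t ≠ j := by
    rintro rfl
    linarith [hA.1.1 t]
  obtain rfl : s = t := by omega
  linarith [hA.2 i j s, hB.2 i j s]

/-- For `n ∈ {2,3}` and polytropes `A, B`,
`A ⊙ B = B ⊙ A` iff `A ⊙ B = A ⊕ B` and `B ⊙ A = A ⊕ B`. -/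
theorem stmt2 {n : ℕ} [NeZero n] (hn : n = 2 ∨ n = 3)
    (A B : Fin n → Fin n → ℝ)
    (hA : IsPolytrope A) (hB : IsPolytrope B) :
    tropMul A B = tropMul B A ↔
      (tropMul A B = tropSum A B ∧ tropMul B A = tropSum A B) := by
  refine ⟨fun h => ?_, fun h => h.1.trans h.2.symm⟩
  have hAB := tropMul_eq_tropSum_of_comm (by omega) hA hB h
  exact ⟨hAB, h ▸ hAB⟩

end TropComm
end

section
/- For n ≥ 3, the set of balanced pairs (ω^x, ω^y) is a linear subspace of ℝ^{n×n} × ℝ^{n×n} of dimension n + 1. -/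
namespace TropComm

/-- The pair `(ωx, ωy)` of weight matrices is *balanced*: for every entry of the
commutator `XY − YX`, all monomials surviving cancellation have equal `ω`-weight.
(i) off-diagonal entries `i ≠ j`; (ii) diagonal entries `i`, where the terms
`x_{ii} y_{ii}` cancel, so only `s ≠ i` appear. -/
def Balanced {n : ℕ} (ωx ωy : Fin n → Fin n → ℝ) : Prop :=
  (∀ i j, i ≠ j → ∀ s t,
    (ωx i s + ωy s j = ωx i t + ωy t j) ∧ (ωx i s + ωy s j = ωy i s + ωx s j)) ∧
  (∀ i, ∀ s t, s ≠ i → t ≠ i →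
    (ωx i s + ωy s i = ωx i t + ωy t i) ∧ (ωx i s + ωy s i = ωy i s + ωx s i))

/-- The pair of weights with `ωy i j = v i - v j + v o` and `ωx = ωy + c`. -/
def weights {n : ℕ} (o : Fin n) :
    (Fin n → ℝ) × ℝ →ₗ[ℝ] (Fin n → Fin n → ℝ) × (Fin n → Fin n → ℝ) where
  toFun q := (fun i j => q.1 i - q.1 j + q.1 o + q.2, fun i j => q.1 i - q.1 j + q.1 o)
  map_add' p q := by
    ext i j <;> simp only [Prod.fst_add, Prod.snd_add, Pi.add_apply] <;> ring
  map_smul' r q := by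
    ext i j <;>
      simp only [Prod.smul_fst, Prod.smul_snd, Pi.smul_apply, smul_eq_mul, RingHom.id_apply] <;>
      ring

lemma weights_injective {n : ℕ} (o : Fin n) : Function.Injective (weights o) := by
  rintro ⟨v, c⟩ ⟨w, d⟩ h
  have hx : ∀ i j, v i - v j + v o + c = w i - w j + w o + d :=
    fun i j => congrFun (congrFun (congrArg Prod.fst h) i) j
  have hy : ∀ i j, v i - v j + v o = w i - w j + w o :=
    fun i j => congrFun (congrFun (congrArg Prod.snd h) i) j
  ext i
  · linarith [hy i o]
  · linarith [hx o o, hy o o]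

lemma balanced_weights {n : ℕ} (o : Fin n) (q : (Fin n → ℝ) × ℝ) :
    Balanced (weights o q).1 (weights o q).2 := by
  constructor
  · intro i j _ s t
    constructor <;> simp only [weights, LinearMap.coe_mk, AddHom.coe_mk] <;> ring
  · intro i s t _ _
    constructor <;> simp only [weights, LinearMap.coe_mk, AddHom.coe_mk] <;> ring

/-- The two weights of a balanced pair differ by a constant. -/
lemma Balanced.sub_eq_sub {n : ℕ} {ωx ωy : Fin n → Fin n → ℝ} (h : Balanced ωx ωy)
    (o i j : Fin n) : ωx i j - ωy i j = ωx o o - ωy o o := by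
  have row : ∀ i j, ωx i j - ωy i j = ωx i i - ωy i i := by
    intro i j
    rcases eq_or_ne i j with rfl | hij
    · rfl
    · linarith [(h.1 i j hij i i).2]
  have diag : ωx i i - ωy i i = ωx o o - ωy o o := by
    rcases eq_or_ne i o with rfl | hio
    · rfl
    · linarith [(h.1 i o hio o o).2, row i o]
  rw [row, diag]

lemma Balanced.cocycle {n : ℕ} {ωx ωy : Fin n → Fin n → ℝ} (h : Balanced ωx ωy)
    {i j : Fin n} (hij : i ≠ j) (s t : Fin n) :
    ωy i s + ωy s j = ωy i t + ωy t j := by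
  linarith [(h.1 i j hij s t).1, h.sub_eq_sub i i s, h.sub_eq_sub i i t]

lemma Balanced.diag_eq {n : ℕ} {ωx ωy : Fin n → Fin n → ℝ} (h : Balanced ωx ωy)
    (i j : Fin n) : ωy i i = ωy j j := by
  rcases eq_or_ne i j with rfl | hij
  · rfl
  · linarith [h.cocycle hij i j]

lemma Balanced.add_swap {n : ℕ} (hn : 3 ≤ n) {ωx ωy : Fin n → Fin n → ℝ}
    (h : Balanced ωx ωy) (o i j : Fin n) : ωy i j + ωy j i = 2 * ωy o o := by
  rcases eq_or_ne i j with rfl | hij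
  · linarith [h.diag_eq i o]
  · obtain ⟨k, hki, hkj⟩ :=
      (Finset.exists_mem_notMem_of_card_lt_card (s := {i, j}) (t := Finset.univ)
        (Finset.card_le_two.trans_lt (by simpa using Nat.lt_of_succ_le hn))).imp
        fun k hk => by simpa using hk.2
    linarith [h.cocycle hkj i k, h.cocycle hki j k, h.diag_eq k o]

lemma Balanced.eq_sub_add {n : ℕ} (hn : 3 ≤ n) {ωx ωy : Fin n → Fin n → ℝ}
    (h : Balanced ωx ωy) (o i j : Fin n) : ωy i j = ωy i o - ωy j o + ωy o o := by
  rcases eq_or_ne i j with rfl | hij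
  · linarith [h.diag_eq i o]
  · linarith [h.cocycle hij i o, h.add_swap hn o o j, h.diag_eq i o]

/-- For n ≥ 3, the set of balanced pairs (ωx, ωy) is a linear
subspace of ℝ^{n×n} × ℝ^{n×n} of dimension n + 1. -/
theorem stmt13 {n : ℕ} (hn : 3 ≤ n) :
    ∃ S : Submodule ℝ ((Fin n → Fin n → ℝ) × (Fin n → Fin n → ℝ)),
      (S : Set ((Fin n → Fin n → ℝ) × (Fin n → Fin n → ℝ)))
        = {p | Balanced p.1 p.2} ∧ Module.finrank ℝ S = n + 1 := by
  let o : Fin n := ⟨0, by omega⟩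
  refine ⟨LinearMap.range (weights o), ?_, ?_⟩
  · ext ⟨ωx, ωy⟩
    constructor
    · rintro ⟨q, hq⟩
      have h := balanced_weights o q
      rwa [hq] at h
    · intro h
      have h : Balanced ωx ωy := h
      refine ⟨(fun i => ωy i o, ωx o o - ωy o o), ?_⟩
      ext i j
      · change ωy i o - ωy j o + ωy o o + (ωx o o - ωy o o) = ωx i j
        linarith [h.eq_sub_add hn o i j, h.sub_eq_sub o i j]
      · exact (h.eq_sub_add hn o i j).symm
  · rw [LinearMap.finrank_range_of_inj (weights_injective o)]
    simp

end TropComm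
end
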